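/- arXiv:1809.01412 — 3 statements merged into one kernel-verified Lean document; each statement's English description precedes it below -/
import Mathlib

section
/- Let 0 ≤ α₁ < α₂ ≤ 1 and let the fixed (non-random) training sample T_n ∈ Z^n be such that the leave-one-out residuals û₁,…,û_n are all distinct. Then for any Borel probability measure P on Z, |P(y₀ ∈ PI^{(L1O)}_{α₁,α₂}(T_n,x₀)) − (⌈nα₂⌉ − ⌈nα₁⌉)/n| ≤ 2·sup_{s∈ℝ} |F̂_n(s) − F̃_n(s)|, where the probability is over (x₀,y₀) ~ P. -/
open MeasureTheory ProbabilityTheory Filter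

noncomputable section

abbrev Vec (p : ℕ) := Fin p → ℝ
abbrev Obs (p : ℕ) := Vec p × ℝ

/-- Remove the `i`-th entry from an `n`-tuple. -/
def erase1 {Z : Type*} {n : ℕ} (T : Fin n → Z) (i : Fin n) (j : Fin (n - 1)) : Z :=
  have hj : (j : ℕ) < n - 1 := j.isLt
  if (j : ℕ) < (i : ℕ) then T ⟨j, by omega⟩ else T ⟨(j : ℕ) + 1, by omega⟩

/-- Remove the first entry from an `n`-tuple. -/
def dropFirst {Z : Type*} {n : ℕ} (T : Fin n → Z) (j : Fin (n - 1)) : Z :=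
  have hj : (j : ℕ) < n - 1 := j.isLt
  T ⟨(j : ℕ) + 1, by omega⟩

/-- The `k`-th smallest entry (0-based, clipped) of a real tuple. -/
def orderStat {n : ℕ} (u : Fin n → ℝ) (k : ℕ) : ℝ :=
  if h : n = 0 then 0 else (u ∘ Tuple.sort u) ⟨min k (n - 1), by omega⟩

/-- Empirical `α`-quantile of a tuple, as in the paper: `û_(⌈nα⌉)` for `α ∈ (0,1]`,
and `û_(1) - e^{-n}` for `α = 0`. -/
def qhat {n : ℕ} (u : Fin n → ℝ) (α : ℝ) : ℝ :=
  if α = 0 then orderStat u 0 - Real.exp (-(n : ℝ)) else orderStat u (⌈(n : ℝ) * α⌉₊ - 1)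

/-- Empirical distribution function of a tuple. -/
def empCDF {n : ℕ} (u : Fin n → ℝ) (s : ℝ) : ℝ :=
  ((Finset.univ.filter fun i : Fin n => u i ≤ s).card : ℝ) / n

/-- Conditional cdf of the prediction error `y₀ - g(x₀)` under `P`. -/
def errCDF {p : ℕ} (P : Measure (Obs p)) (g : Vec p → ℝ) (s : ℝ) : ℝ :=
  (P {z : Obs p | z.2 - g z.1 ≤ s}).toReal

/-- Coverage probability of the interval `(g(x₀)+q₁, g(x₀)+q₂]` under `P`. -/
def coverProb {p : ℕ} (P : Measure (Obs p)) (g : Vec p → ℝ) (q₁ q₂ : ℝ) : ℝ :=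
  (P {z : Obs p | g z.1 + q₁ < z.2 ∧ z.2 ≤ g z.1 + q₂}).toReal

/-- Condition (C1): `m` is the regression function of `P`, the error `u₀ = y₀ - m(x₀)` is
independent of `x₀` and has (bounded, nonnegative) Lebesgue density `f`. -/
def IsC1 {p : ℕ} (P : Measure (Obs p)) (m : Vec p → ℝ) (f : ℝ → ℝ) : Prop :=
  Measurable m ∧ (∀ s, 0 ≤ f s) ∧ BddAbove (Set.range f) ∧
    IndepFun (fun z : Obs p => z.1) (fun z : Obs p => z.2 - m z.1) P ∧
    Measure.map (fun z : Obs p => z.2 - m z.1) P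
      = volume.withDensity (fun s => ENNReal.ofReal (f s)) ∧
    Integrable (fun z : Obs p => z.2 - m z.1) P ∧
    (∫ z, (z.2 - m z.1) ∂P) = 0


/-- Leave-one-out residuals. -/
def looResid {p n : ℕ} (Mloo : (Fin (n - 1) → Obs p) → Vec p → ℝ)
    (T : Fin n → Obs p) (i : Fin n) : ℝ :=
  (T i).2 - Mloo (erase1 T i) (T i).1

lemma orderStat_of_lt {n : ℕ} (u : Fin n → ℝ) (k : ℕ) (hk : k < n) :
    orderStat u k = u (Tuple.sort u ⟨k, hk⟩) := by
  have h : n ≠ 0 := by omega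
  have hmin : min k (n - 1) = k := by omega
  simp [orderStat, h, hmin]

lemma empCDF_comp_perm {n : ℕ} (u : Fin n → ℝ) (σ : Equiv.Perm (Fin n)) (s : ℝ) :
    empCDF (u ∘ σ) s = empCDF u s := by
  have h : (Finset.univ.filter fun i : Fin n => u i ≤ s)
      = (Finset.univ.filter fun i : Fin n => (u ∘ σ) i ≤ s).map σ.toEmbedding := by
    ext i
    simp [Finset.mem_map_equiv]
  simp only [empCDF, h, Finset.card_map]

lemma orderStat_mono {n : ℕ} (u : Fin n → ℝ) : Monotone (orderStat u) := by
  intro j k hjk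
  unfold orderStat
  split_ifs
  · exact le_rfl
  · exact Tuple.monotone_sort u (Fin.mk_le_mk.2 (min_le_min_right _ hjk))

lemma empCDF_orderStat {n : ℕ} {u : Fin n → ℝ} (hu : Function.Injective u) {k : ℕ}
    (hk : k < n) : empCDF u (orderStat u k) = ((k + 1 : ℕ) : ℝ) / n := by
  have hmono : StrictMono (u ∘ Tuple.sort u) :=
    (Tuple.monotone_sort u).strictMono_of_injective (hu.comp (Tuple.sort u).injective)
  have hfilter : (Finset.univ.filter fun i : Fin n =>
      (u ∘ Tuple.sort u) i ≤ (u ∘ Tuple.sort u) ⟨k, hk⟩) = Finset.Iic ⟨k, hk⟩ := by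
    ext i
    simp only [Finset.mem_filter, Finset.mem_univ, true_and, Finset.mem_Iic, hmono.le_iff_le]
  rw [orderStat_of_lt u k hk, ← empCDF_comp_perm u (Tuple.sort u)]
  change ((Finset.univ.filter fun i : Fin n =>
      (u ∘ Tuple.sort u) i ≤ (u ∘ Tuple.sort u) ⟨k, hk⟩).card : ℝ) / n = _
  rw [hfilter, Fin.card_Iic]

lemma orderStat_zero_le {n : ℕ} (u : Fin n → ℝ) (i : Fin n) : orderStat u 0 ≤ u i := by
  have hn : 0 < n := i.pos
  rw [orderStat_of_lt u 0 hn]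
  have h := Tuple.monotone_sort u
    (show (⟨0, hn⟩ : Fin n) ≤ (Tuple.sort u).symm i from Fin.mk_le_of_le_val (Nat.zero_le _))
  simpa using h

lemma empCDF_qhat {n : ℕ} (hn : 0 < n) {u : Fin n → ℝ} (hu : Function.Injective u) {α : ℝ}
    (h₀ : 0 ≤ α) (h₁ : α ≤ 1) : empCDF u (qhat u α) = (⌈(n : ℝ) * α⌉₊ : ℝ) / n := by
  rcases h₀.eq_or_lt with rfl | hpos
  · have hempty : (Finset.univ.filter fun i : Fin n => u i ≤ qhat u 0) = ∅ := by
      refine Finset.filter_eq_empty_iff.2 fun i _ => not_le.2 ?_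
      have := orderStat_zero_le u i
      have := Real.exp_pos (-(n : ℝ))
      simp only [qhat, if_true]
      linarith
    simp [empCDF, hempty]
  · have hceil : 0 < ⌈(n : ℝ) * α⌉₊ := Nat.ceil_pos.2 (by positivity)
    have hle : ⌈(n : ℝ) * α⌉₊ ≤ n :=
      Nat.ceil_le.2 (mul_le_of_le_one_right (Nat.cast_nonneg n) h₁)
    rw [qhat, if_neg hpos.ne', empCDF_orderStat hu (by omega), Nat.sub_add_cancel hceil]

lemma qhat_mono {n : ℕ} (u : Fin n → ℝ) {α β : ℝ} (h₀ : 0 ≤ α) (h : α ≤ β) :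
    qhat u α ≤ qhat u β := by
  have hexp := Real.exp_pos (-(n : ℝ))
  unfold qhat
  split_ifs with hα hβ hβ
  · exact le_rfl
  · have := orderStat_mono u (Nat.zero_le (⌈(n : ℝ) * β⌉₊ - 1))
    linarith
  · exact absurd (le_antisymm (h.trans hβ.le) h₀) hα
  · exact orderStat_mono u (Nat.sub_le_sub_right
      (Nat.ceil_mono (mul_le_mul_of_nonneg_left h (Nat.cast_nonneg n))) 1)

lemma coverProb_eq_errCDF_sub {p : ℕ} (P : Measure (Obs p)) [IsProbabilityMeasure P]
    {g : Vec p → ℝ} (hg : Measurable g) {q₁ q₂ : ℝ} (h : q₁ ≤ q₂) :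
    coverProb P g q₁ q₂ = errCDF P g q₂ - errCDF P g q₁ := by
  have hmeas : Measurable fun z : Obs p => z.2 - g z.1 :=
    measurable_snd.sub (hg.comp measurable_fst)
  have hset : {z : Obs p | g z.1 + q₁ < z.2 ∧ z.2 ≤ g z.1 + q₂}
      = {z : Obs p | z.2 - g z.1 ≤ q₂} \ {z : Obs p | z.2 - g z.1 ≤ q₁} := by
    ext z
    simp only [Set.mem_ofPred_eq, Set.mem_sdiff, not_le, sub_le_iff_le_add']
    exact and_comm
  unfold coverProb errCDF
  rw [hset]
  exact measureReal_sdiff (fun z hz => le_trans hz h)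
    (measurableSet_le hmeas measurable_const)

lemma bddAbove_abs_empCDF_sub_errCDF {p n : ℕ} (u : Fin n → ℝ) (P : Measure (Obs p))
    [IsProbabilityMeasure P] (g : Vec p → ℝ) :
    BddAbove (Set.range fun s : ℝ => |empCDF u s - errCDF P g s|) := by
  refine ⟨1, ?_⟩
  rintro _ ⟨s, rfl⟩
  have herr₀ : 0 ≤ errCDF P g s := ENNReal.toReal_nonneg
  have herr₁ : errCDF P g s ≤ 1 := measureReal_le_one
  have hemp₀ : 0 ≤ empCDF u s := by unfold empCDF; positivity
  have hemp₁ : empCDF u s ≤ 1 := by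
    refine div_le_one_of_le₀ ?_ (Nat.cast_nonneg n)
    exact_mod_cast (Finset.card_filter_le _ _).trans_eq (by simp)
  exact abs_sub_le_iff.2 ⟨by linarith, by linarith⟩

/-- Lemma 1 of the paper: for a fixed training sample with pairwise distinct
leave-one-out residuals, the conditional coverage probability of the leave-one-out prediction
interval differs from `(⌈nα₂⌉ - ⌈nα₁⌉)/n` by at most `2‖F̂ₙ - F̃ₙ‖_∞`. -/
theorem stmt0 {p n : ℕ} (hn : 0 < n) (P : Measure (Obs p)) [IsProbabilityMeasure P]
    (Mfull : (Fin n → Obs p) → Vec p → ℝ) (Mloo : (Fin (n - 1) → Obs p) → Vec p → ℝ)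
    (hMfull : ∀ T, Measurable (Mfull T)) (hMloo : ∀ T, Measurable (Mloo T))
    (T : Fin n → Obs p)
    (hdistinct : Function.Injective (looResid Mloo T))
    (α₁ α₂ : ℝ) (h₀ : 0 ≤ α₁) (h₁₂ : α₁ < α₂) (h₂ : α₂ ≤ 1) :
    |coverProb P (Mfull T) (qhat (looResid Mloo T) α₁) (qhat (looResid Mloo T) α₂)
        - ((⌈(n : ℝ) * α₂⌉₊ : ℝ) - (⌈(n : ℝ) * α₁⌉₊ : ℝ)) / n|
      ≤ 2 * ⨆ s : ℝ, |empCDF (looResid Mloo T) s - errCDF P (Mfull T) s| := by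
  set u := looResid Mloo T
  set g := Mfull T
  rw [coverProb_eq_errCDF_sub P (hMfull T) (qhat_mono u h₀ h₁₂.le), sub_div,
    ← empCDF_qhat hn hdistinct h₀ (h₁₂.le.trans h₂),
    ← empCDF_qhat hn hdistinct (h₀.trans h₁₂.le) h₂]
  have hbdd := bddAbove_abs_empCDF_sub_errCDF u P g
  have hsup₁ := abs_le.1 (le_ciSup hbdd (qhat u α₁))
  have hsup₂ := abs_le.1 (le_ciSup hbdd (qhat u α₂))
  exact abs_le.2 ⟨by linarith, by linarith⟩

end
end

section
/- Let 𝒫 be a collection of probability measures on Z = X × Y satisfying Condition (C1). Then for every t ∈ ℝ and every P ∈ 𝒫: E_{P^{n+1}}[|1{y₀ − m̂_n(x₀) ≤ t} − 1{y₀ − m̂_n^{[1]}(x₀) ≤ t}|] ≤ 2 E_{P^{n+1}}[(‖f_{u,P}‖_∞ |m̂_n(x₀) − m̂_n^{[1]}(x₀)|) ∧ 1]. -/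
open MeasureTheory ProbabilityTheory Filter Topology

noncomputable section

/-- The training part of a sample `ω : Fin (n+1) → Z` (coordinate `0` is `z₀`). -/
def train {Z : Type*} {n : ℕ} (ω : Fin (n + 1) → Z) (i : Fin n) : Z := ω i.succ

theorem measurable_train {Z : Type*} [MeasurableSpace Z] {n : ℕ} :
    Measurable (train : (Fin (n + 1) → Z) → Fin n → Z) :=
  measurable_pi_lambda _ fun i => measurable_pi_apply i.succ

theorem measurable_dropFirst {Z : Type*} [MeasurableSpace Z] {n : ℕ} :
    Measurable (dropFirst : (Fin n → Z) → Fin (n - 1) → Z) :=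
  measurable_pi_lambda _ fun _ => measurable_pi_apply _

/-- The first observation and the training part are independent with the product law. -/
theorem map_zero_train_pi {Z : Type*} [MeasurableSpace Z] {n : ℕ}
    (P : Measure Z) [IsProbabilityMeasure P] :
    (Measure.pi fun _ : Fin (n + 1) => P).map (fun ω => (ω 0, train ω))
      = P.prod (Measure.pi fun _ : Fin n => P) :=
  (measurePreserving_piFinSuccAbove (fun _ : Fin (n + 1) => P) 0).map_eq

/-- A bounded density assigns to an interval at most the bound times the length. -/
theorem withDensity_Ioc_le {f : ℝ → ℝ} (hf : BddAbove (Set.range f)) (a b : ℝ) :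
    (volume.withDensity fun s => ENNReal.ofReal (f s)) (Set.Ioc a b)
      ≤ ENNReal.ofReal (⨆ s, f s) * ENNReal.ofReal (b - a) := by
  rw [withDensity_apply _ measurableSet_Ioc]
  calc ∫⁻ s in Set.Ioc a b, ENNReal.ofReal (f s)
      ≤ ∫⁻ _ in Set.Ioc a b, ENNReal.ofReal (⨆ s, f s) :=
        lintegral_mono fun s => ENNReal.ofReal_le_ofReal (le_ciSup hf s)
    _ = _ := by rw [setLIntegral_const, Real.volume_Ioc]

/-- The difference of two threshold indicators lives on the interval between the thresholds. -/
theorem ofReal_abs_sub_threshold_le (c m g h t : ℝ) :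
    ENNReal.ofReal |(if c + m - g ≤ t then (1 : ℝ) else 0) - (if c + m - h ≤ t then 1 else 0)|
      ≤ (Set.Ioc (t - m + min g h) (t - m + max g h)).indicator 1 c := by
  by_cases hc : c ∈ Set.Ioc (t - m + min g h) (t - m + max g h)
  · rw [Set.indicator_of_mem hc]
    split_ifs <;> simp
  · rw [Set.indicator_of_notMem hc]
    split_ifs with h₁ h₂ h₂
    · simp
    · refine absurd ⟨?_, ?_⟩ hc
      · linarith [min_le_right g h]
      · linarith [le_max_left g h]
    · refine absurd ⟨?_, ?_⟩ hc
      · linarith [min_le_left g h]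
      · linarith [le_max_right g h]
    · simp

/-- Under (C1), `P` is the image of a product of the covariate law and the error law. -/
theorem IsC1.map_prod {p : ℕ} {P : Measure (Obs p)} [IsProbabilityMeasure P]
    {m : Vec p → ℝ} {f : ℝ → ℝ} (hC1 : IsC1 P m f) :
    ((P.map fun z => z.1).prod (P.map fun z => z.2 - m z.1)).map
      (fun q : Vec p × ℝ => ((q.1, q.2 + m q.1) : Obs p)) = P := by
  obtain ⟨hm, -, -, hind, -⟩ := hC1
  have hu : Measurable fun z : Obs p => z.2 - m z.1 :=
    measurable_snd.sub (hm.comp measurable_fst)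
  rw [← (indepFun_iff_map_prod_eq_prod_map_map measurable_fst.aemeasurable
    hu.aemeasurable).1 hind, Measure.map_map (by fun_prop) (by fun_prop)]
  convert Measure.map_id
  ext z <;> simp

theorem IsC1.lintegral_abs_sub_threshold_le {p : ℕ} {P : Measure (Obs p)}
    [IsProbabilityMeasure P] {m : Vec p → ℝ} {f : ℝ → ℝ} (hC1 : IsC1 P m f)
    {g h : Vec p → ℝ} (hg : Measurable g) (hh : Measurable h) (t : ℝ) :
    ∫⁻ z, ENNReal.ofReal |(if z.2 - g z.1 ≤ t then (1 : ℝ) else 0)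
        - (if z.2 - h z.1 ≤ t then 1 else 0)| ∂P
      ≤ ∫⁻ z, ENNReal.ofReal (min ((⨆ s, f s) * |g z.1 - h z.1|) 1) ∂P := by
  have hmap := hC1.map_prod
  obtain ⟨hm, hf0, hfb, -, hlaw, -⟩ := hC1
  have hu : Measurable fun z : Obs p => z.2 - m z.1 :=
    measurable_snd.sub (hm.comp measurable_fst)
  have : IsProbabilityMeasure (P.map fun z => z.1) :=
    Measure.isProbabilityMeasure_map measurable_fst.aemeasurable
  have : IsProbabilityMeasure (P.map fun z => z.2 - m z.1) :=
    Measure.isProbabilityMeasure_map hu.aemeasurable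
  have hF : Measurable fun z : Obs p => ENNReal.ofReal
      |(if z.2 - g z.1 ≤ t then (1 : ℝ) else 0) - (if z.2 - h z.1 ≤ t then 1 else 0)| :=
    (((Measurable.ite (measurableSet_le (by fun_prop) measurable_const) measurable_const
      measurable_const).sub (Measurable.ite (measurableSet_le (by fun_prop) measurable_const)
      measurable_const measurable_const)).abs).ennreal_ofReal
  have hs : Measurable fun q : Vec p × ℝ => ((q.1, q.2 + m q.1) : Obs p) := by fun_prop
  have hG : Measurable fun x : Vec p =>
      ENNReal.ofReal (min ((⨆ s, f s) * |g x - h x|) 1) := by fun_prop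
  rw [← lintegral_map hG (measurable_fst : Measurable fun z : Obs p => z.1)]
  conv_lhs => rw [← hmap]
  rw [lintegral_map hF hs]
  refine (lintegral_prod_le _).trans ?_
  refine lintegral_mono fun x => ?_
  calc _ ≤ ∫⁻ c, (Set.Ioc (t - m x + min (g x) (h x)) (t - m x + max (g x) (h x))).indicator 1 c
          ∂(P.map fun z => z.2 - m z.1) :=
        lintegral_mono fun c => ofReal_abs_sub_threshold_le c (m x) (g x) (h x) t
    _ = (P.map fun z => z.2 - m z.1)
          (Set.Ioc (t - m x + min (g x) (h x)) (t - m x + max (g x) (h x))) :=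
        lintegral_indicator_one measurableSet_Ioc
    _ ≤ ENNReal.ofReal (min ((⨆ s, f s) * |g x - h x|) 1) := by
        rw [ENNReal.ofReal_min, ENNReal.ofReal_one]
        refine le_min ?_ prob_le_one
        rw [hlaw, ENNReal.ofReal_mul (Real.iSup_nonneg hf0)]
        refine (withDensity_Ioc_le hfb _ _).trans_eq ?_
        rw [add_sub_add_left_eq_sub, max_sub_min_eq_abs']

/-- Lemma 3 of the paper. -/
theorem stmt3 {p n : ℕ}
    (P : Measure (Obs p)) [IsProbabilityMeasure P]
    (mreg : Vec p → ℝ) (f : ℝ → ℝ) (hC1 : IsC1 P mreg f)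
    (Mfull : (Fin n → Obs p) → Vec p → ℝ) (Mloo : (Fin (n - 1) → Obs p) → Vec p → ℝ)
    (hMfull : Measurable (Function.uncurry Mfull)) (hMloo : Measurable (Function.uncurry Mloo))
    (t : ℝ) :
    (∫ ω : Fin (n + 1) → Obs p,
        |(if (ω 0).2 - Mfull (train ω) (ω 0).1 ≤ t then (1 : ℝ) else 0)
          - (if (ω 0).2 - Mloo (dropFirst (train ω)) (ω 0).1 ≤ t then (1 : ℝ) else 0)|
        ∂(Measure.pi fun _ : Fin (n + 1) => P))
      ≤ 2 * ∫ ω : Fin (n + 1) → Obs p,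
          min ((⨆ s : ℝ, f s) * |Mfull (train ω) (ω 0).1
              - Mloo (dropFirst (train ω)) (ω 0).1|) 1
          ∂(Measure.pi fun _ : Fin (n + 1) => P) := by
  have hS : 0 ≤ ⨆ s, f s := Real.iSup_nonneg hC1.2.1
  have h0 : Measurable fun q : Obs p × (Fin n → Obs p) => Mfull q.2 q.1.1 :=
    hMfull.comp (measurable_snd.prodMk measurable_fst.fst)
  have h1 : Measurable fun q : Obs p × (Fin n → Obs p) => Mloo (dropFirst q.2) q.1.1 :=
    hMloo.comp ((measurable_dropFirst.comp measurable_snd).prodMk measurable_fst.fst)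
  have hφ : Measurable fun ω : Fin (n + 1) → Obs p => (ω 0, train ω) :=
    (measurable_pi_apply 0).prodMk measurable_train
  let F : Obs p × (Fin n → Obs p) → ℝ := fun q =>
    |(if q.1.2 - Mfull q.2 q.1.1 ≤ t then (1 : ℝ) else 0)
      - (if q.1.2 - Mloo (dropFirst q.2) q.1.1 ≤ t then (1 : ℝ) else 0)|
  let G : Obs p × (Fin n → Obs p) → ℝ := fun q =>
    min ((⨆ s, f s) * |Mfull q.2 q.1.1 - Mloo (dropFirst q.2) q.1.1|) 1
  have hF : Measurable F :=
    ((Measurable.ite (measurableSet_le (measurable_fst.snd.sub h0) measurable_const) measurable_const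
      measurable_const).sub (Measurable.ite (measurableSet_le (measurable_fst.snd.sub h1) measurable_const)
      measurable_const measurable_const)).abs
  have hG : Measurable G := ((h0.sub h1).abs.const_mul _).min measurable_const
  have hF0 : ∀ q, 0 ≤ F q := fun q => abs_nonneg _
  have hG0 : ∀ q, 0 ≤ G q := fun q => le_min (mul_nonneg hS (abs_nonneg _)) zero_le_one
  obtain ⟨ν, hν, hmap⟩ : ∃ ν : Measure (Fin n → Obs p), IsProbabilityMeasure ν ∧
      (Measure.pi fun _ : Fin (n + 1) => P).map (fun ω => (ω 0, train ω)) = P.prod ν :=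
    ⟨_, inferInstance, map_zero_train_pi P⟩
  have hle : ∫⁻ q, ENNReal.ofReal (F q) ∂(P.prod ν)
      ≤ ∫⁻ q, ENNReal.ofReal (G q) ∂(P.prod ν) := by
    rw [lintegral_prod_symm _ hF.ennreal_ofReal.aemeasurable,
      lintegral_prod_symm _ hG.ennreal_ofReal.aemeasurable]
    exact lintegral_mono fun T => hC1.lintegral_abs_sub_threshold_le
      (hMfull.comp measurable_prodMk_left) (hMloo.comp measurable_prodMk_left) t
  have hfin : ∫⁻ q, ENNReal.ofReal (G q) ∂(P.prod ν) ≠ ⊤ := by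
    refine ne_top_of_le_ne_top ENNReal.one_ne_top ?_
    calc _ ≤ ∫⁻ _, 1 ∂(P.prod ν) :=
          lintegral_mono fun q => ENNReal.ofReal_le_one.2 (min_le_right _ _)
      _ = 1 := by simp
  have key : ∫ q, F q ∂(P.prod ν)
      ≤ ∫ q, G q ∂(P.prod ν) := by
    rw [integral_eq_lintegral_of_nonneg_ae (ae_of_all _ hF0) hF.aestronglyMeasurable,
      integral_eq_lintegral_of_nonneg_ae (ae_of_all _ hG0) hG.aestronglyMeasurable]
    exact ENNReal.toReal_mono hfin hle
  have hpos : 0 ≤ ∫ q, G q ∂(P.prod ν) := integral_nonneg hG0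
  rw [← hmap, integral_map hφ.aemeasurable hG.aestronglyMeasurable] at key hpos
  rw [integral_map hφ.aemeasurable hF.aestronglyMeasurable] at key
  exact key.trans (le_mul_of_one_le_left hpos one_le_two)

end
end

section
/- Let n ≥ 1, p ≥ 1 and α ∈ (0,1/2), and let P_j = 𝒩_{p+1}(0, σ_j² I_{p+1}) for j = 0,1 with σ₀² ≠ σ₁², σ_j² > 0. Then there is no triple of measurable functions β̂_n: (ℝ^{p+1})^n → ℝ^p, L_α: (ℝ^{p+1})^n → ℝ and U_α: (ℝ^{p+1})^n → ℝ such that for both j = 0 and j = 1, for P_j^n-almost all training samples T_n, the conditional coverage given T_n is exact: P_j(y₀ ∈ [x₀'β̂_n(T_n) + L_α(T_n), x₀'β̂_n(T_n) + U_α(T_n)]) = 1 − α, where (x₀,y₀) ~ P_j is independent of T_n. -/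
open MeasureTheory ProbabilityTheory Filter Topology
open scoped ENNReal NNReal

noncomputable section

/-- The centered Gaussian distribution `𝒩_{p+1}(0, v·I_{p+1})` on `ℝ^p × ℝ`,
realized as a product of independent one-dimensional centered Gaussians. -/
def isoGauss (p : ℕ) (v : ℝ≥0) : Measure (Obs p) :=
  (Measure.pi fun _ : Fin p => gaussianReal 0 v).prod (gaussianReal 0 v)

instance isProbabilityMeasure_isoGauss (p : ℕ) (v : ℝ≥0) :
    IsProbabilityMeasure (isoGauss p v) := by
  unfold isoGauss; infer_instance

lemma pi_fin_absolutelyContinuous {X : Type*} [MeasurableSpace X] {μ ν : Measure X}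
    [SigmaFinite μ] [SigmaFinite ν] (h : μ ≪ ν) (n : ℕ) :
    (Measure.pi fun _ : Fin n => μ) ≪ Measure.pi fun _ : Fin n => ν := by
  induction n with
  | zero =>
    rw [Measure.pi_of_empty, Measure.pi_of_empty]
  | succ n ih =>
    have hμ := (measurePreserving_piFinSuccAbove (fun _ : Fin (n + 1) => μ) 0).symm.map_eq
    have hν := (measurePreserving_piFinSuccAbove (fun _ : Fin (n + 1) => ν) 0).symm.map_eq
    rw [← hμ, ← hν]
    exact (h.prod ih).map (MeasurableEquiv.measurable _)

lemma gaussianReal_absolutelyContinuous_gaussianReal (m₁ m₂ : ℝ) {v w : ℝ≥0}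
    (hv : v ≠ 0) (hw : w ≠ 0) : gaussianReal m₁ v ≪ gaussianReal m₂ w :=
  (gaussianReal_absolutelyContinuous m₁ hv).trans (gaussianReal_absolutelyContinuous' m₂ hw)

lemma isoGauss_absolutelyContinuous (p : ℕ) {v w : ℝ≥0} (hv : v ≠ 0) (hw : w ≠ 0) :
    isoGauss p v ≪ isoGauss p w := by
  have h := gaussianReal_absolutelyContinuous_gaussianReal 0 0 hv hw
  exact (pi_fin_absolutelyContinuous h p).prod h

lemma isOpenPosMeasure_isoGauss (p : ℕ) {v : ℝ≥0} (hv : v ≠ 0) :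
    (isoGauss p v).IsOpenPosMeasure := by
  have : (gaussianReal 0 v).IsOpenPosMeasure :=
    (gaussianReal_absolutelyContinuous' 0 hv).isOpenPosMeasure
  unfold isoGauss; infer_instance

lemma isoGauss_map_smul (p : ℕ) (v : ℝ≥0) (c : ℝ) :
    (isoGauss p v).map (fun z => c • z) = isoGauss p (NNReal.mk (c ^ 2) (sq_nonneg c) * v) := by
  have h1 : (gaussianReal 0 v).map (fun x => c * x)
      = gaussianReal 0 (NNReal.mk (c ^ 2) (sq_nonneg c) * v) := by
    simpa using gaussianReal_map_const_mul (μ := 0) (v := v) c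
  have h2 := Measure.pi_map_pi (ι := Fin p) (μ := fun _ => gaussianReal 0 v)
    (f := fun _ x => c * x) (fun _ => (measurable_const_mul c).aemeasurable)
  unfold isoGauss
  rw [← h1, ← h2, Measure.map_prod_map _ _ (by fun_prop) (by fun_prop)]
  rfl

/-- The residual `y - x'b` of the linear predictor `b`. -/
def linearResidual {p : ℕ} (b : Vec p) (z : Obs p) : ℝ := z.2 - ∑ k, z.1 k * b k

lemma continuous_linearResidual {p : ℕ} (b : Vec p) : Continuous (linearResidual b) := by
  unfold linearResidual; fun_prop

lemma linearResidual_smul {p : ℕ} (b : Vec p) (c : ℝ) (z : Obs p) :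
    linearResidual b (c • z) = c * linearResidual b z := by
  simp [linearResidual, mul_sub, Finset.mul_sum, mul_assoc]

lemma isoGauss_linearResidual_eq_zero {p : ℕ} (b : Vec p) {v : ℝ≥0} (hv : v ≠ 0) :
    isoGauss p v {z | linearResidual b z = 0} = 0 := by
  have := nullSingletonClass_gaussianReal (μ := 0) hv
  refine (Measure.measure_prod_null
    (measurableSet_eq_fun (continuous_linearResidual b).measurable measurable_const)).2 ?_
  refine Eventually.of_forall fun x => ?_
  have : Prod.mk x ⁻¹' {z : Obs p | linearResidual b z = 0} = {∑ k, x k * b k} := by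
    ext y; simp [linearResidual, sub_eq_zero]
  simp only [this, measure_singleton, Pi.zero_apply]

lemma isoGauss_linearResidual_neg {p : ℕ} (b : Vec p) (v : ℝ≥0) {s : Set ℝ} (hs : MeasurableSet s) :
    isoGauss p v {z | -linearResidual b z ∈ s} = isoGauss p v {z | linearResidual b z ∈ s} := by
  have h := isoGauss_map_smul p v (-1)
  have h1 : NNReal.mk ((-1 : ℝ) ^ 2) (sq_nonneg _) * v = v := by ext; simp
  rw [h1] at h
  conv_rhs => rw [← h]
  have hms : MeasurableSet {z : Obs p | linearResidual b z ∈ s} :=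
    (continuous_linearResidual b).measurable hs
  rw [Measure.map_apply (by fun_prop) hms]
  congr 1; ext z
  simp only [Set.mem_preimage, Set.mem_ofPred_eq, linearResidual_smul, neg_one_mul]

lemma isoGauss_linearResidual_nonneg_le {p : ℕ} (b : Vec p) {v : ℝ≥0} (hv : v ≠ 0) :
    (isoGauss p v).real {z | 0 ≤ linearResidual b z} ≤ 1 / 2 := by
  have hm := (continuous_linearResidual b).measurable
  have hpos : (isoGauss p v).real {z | 0 ≤ linearResidual b z}
      ≤ (isoGauss p v).real {z | 0 < linearResidual b z} := by
    have h0 : (isoGauss p v).real {z | linearResidual b z = 0} = 0 := by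
      simp [Measure.real, isoGauss_linearResidual_eq_zero b hv]
    have hsub : {z | 0 ≤ linearResidual b z} ⊆ {z | 0 < linearResidual b z} ∪ {z | linearResidual b z = 0} := by
      intro z hz
      rcases (show 0 ≤ linearResidual b z from hz).lt_or_eq with h | h
      · exact Or.inl h
      · exact Or.inr h.symm
    have := (measureReal_mono hsub).trans (measureReal_union_le (μ := isoGauss p v) _ _)
    linarith
  have hneg : (isoGauss p v).real {z | linearResidual b z < 0}
      = (isoGauss p v).real {z | 0 < linearResidual b z} := by
    have := isoGauss_linearResidual_neg b v (measurableSet_Ioi (a := (0 : ℝ)))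
    simp only [Set.mem_Ioi, neg_pos] at this
    simp [Measure.real, this]
  have hdisj : Disjoint {z | linearResidual b z < 0} {z | 0 < linearResidual b z} :=
    Set.disjoint_left.2 fun z h1 h2 => lt_asymm (show linearResidual b z < 0 from h1) h2
  have hu := measureReal_union (μ := isoGauss p v) hdisj (measurableSet_lt measurable_const hm)
  have h1 : (isoGauss p v).real ({z | linearResidual b z < 0} ∪ {z | 0 < linearResidual b z}) ≤ 1 :=
    measureReal_le_one
  linarith

lemma isoGauss_linearResidual_nonpos_le {p : ℕ} (b : Vec p) {v : ℝ≥0} (hv : v ≠ 0) :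
    (isoGauss p v).real {z | linearResidual b z ≤ 0} ≤ 1 / 2 := by
  have := isoGauss_linearResidual_neg b v (measurableSet_Ici (a := (0 : ℝ)))
  simp only [Set.mem_Ici, neg_nonneg] at this
  rw [Measure.real, this]
  exact isoGauss_linearResidual_nonneg_le b hv

/-- A band of residuals with probability above one half has a strictly smaller probability
under the isotropic Gaussian with the larger variance. -/
lemma isoGauss_linearResidual_Icc_lt {p : ℕ} (b : Vec p) {v w : ℝ≥0} (hv : 0 < v) (hvw : v < w)
    {l u : ℝ} (h : 1 / 2 < (isoGauss p v).real {z | linearResidual b z ∈ Set.Icc l u}) :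
    (isoGauss p w).real {z | linearResidual b z ∈ Set.Icc l u}
      < (isoGauss p v).real {z | linearResidual b z ∈ Set.Icc l u} := by
  have hm := (continuous_linearResidual b).measurable
  have hl : l < 0 := by
    by_contra! hl
    have := measureReal_mono (μ := isoGauss p v)
      (s₁ := {z | linearResidual b z ∈ Set.Icc l u}) (s₂ := {z | 0 ≤ linearResidual b z})
      fun z hz => hl.trans hz.1
    linarith [isoGauss_linearResidual_nonneg_le b hv.ne']
  have hu : 0 < u := by
    by_contra! hu
    have := measureReal_mono (μ := isoGauss p v)
      (s₁ := {z | linearResidual b z ∈ Set.Icc l u}) (s₂ := {z | linearResidual b z ≤ 0})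
      fun z hz => hz.2.trans hu
    linarith [isoGauss_linearResidual_nonpos_le b hv.ne']
  have hv' : (0 : ℝ) < v := hv
  have hvw' : (v : ℝ) < w := hvw
  obtain ⟨c, hc1, hcw⟩ : ∃ c : ℝ, 1 < c ∧ NNReal.mk (c ^ 2) (sq_nonneg c) * v = w := by
    refine ⟨√(w / v), Real.lt_sqrt_of_sq_lt (by rw [one_pow, one_lt_div hv']; exact hvw'), ?_⟩
    ext
    simp only [NNReal.coe_mul, NNReal.coe_mk]
    rw [Real.sq_sqrt (by positivity)]
    field_simp
  have hc0 : 0 < c := one_pos.trans hc1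
  have hscale : (isoGauss p w).real {z | linearResidual b z ∈ Set.Icc l u}
      = (isoGauss p v).real {z | c * linearResidual b z ∈ Set.Icc l u} := by
    have hms : MeasurableSet {z : Obs p | linearResidual b z ∈ Set.Icc l u} :=
      hm measurableSet_Icc
    rw [← hcw, ← isoGauss_map_smul, Measure.real, Measure.map_apply (by fun_prop) hms,
      Measure.real]
    congr 2; ext z
    simp only [Set.mem_preimage, Set.mem_ofPred_eq, linearResidual_smul]
  have hopen : 0 < (isoGauss p v).real {z | u < c * linearResidual b z ∧ linearResidual b z < u} := by
    have := isOpenPosMeasure_isoGauss p hv.ne'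
    have ho : IsOpen {z : Obs p | u < c * linearResidual b z ∧ linearResidual b z < u} :=
      (isOpen_lt continuous_const (continuous_const.mul (continuous_linearResidual b))).inter
        (isOpen_lt (continuous_linearResidual b) continuous_const)
    have hlt : u / c < u := div_lt_self hu hc1
    obtain ⟨y, hy1, hy2⟩ := exists_between hlt
    have hne : {z : Obs p | u < c * linearResidual b z ∧ linearResidual b z < u}.Nonempty :=
      ⟨(0, y), by simpa [linearResidual] using ⟨(div_lt_iff₀' hc0).1 hy1, hy2⟩⟩
    exact ENNReal.toReal_pos (ho.measure_pos _ hne).ne' (measure_ne_top _ _)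
  have hdisj : Disjoint {z : Obs p | c * linearResidual b z ∈ Set.Icc l u}
      {z | u < c * linearResidual b z ∧ linearResidual b z < u} :=
    Set.disjoint_left.2 fun z h1 h2 => h2.1.not_ge h1.2
  have hunion := measureReal_union (μ := isoGauss p v) hdisj
    ((measurableSet_lt measurable_const (hm.const_mul c)).inter
      (measurableSet_lt hm measurable_const))
  have hsub : {z : Obs p | c * linearResidual b z ∈ Set.Icc l u}
      ∪ {z | u < c * linearResidual b z ∧ linearResidual b z < u} ⊆ {z | linearResidual b z ∈ Set.Icc l u} := by
    rintro z (⟨h1, h2⟩ | ⟨h1, h2⟩)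
    · constructor <;> nlinarith
    · constructor <;> nlinarith
  have := measureReal_mono (μ := isoGauss p v) hsub
  linarith

/-- Remark 1 of the paper: no finite-sample exactly conditionally valid
prediction interval around a linear predictor exists, once the model contains two isotropic
Gaussian distributions with different variances. -/
theorem stmt18 (n p : ℕ) (hn : 1 ≤ n) (hp : 1 ≤ p)
    (α : ℝ) (hα0 : 0 < α) (hα2 : α < 1 / 2)
    (v : Fin 2 → ℝ≥0) (hv : v 0 ≠ v 1) (hvpos : ∀ j, 0 < v j) :
    ¬ ∃ (bhat : (Fin n → Obs p) → Vec p) (L U : (Fin n → Obs p) → ℝ),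
        Measurable bhat ∧ Measurable L ∧ Measurable U ∧
        ∀ j : Fin 2, ∀ᵐ T ∂(Measure.pi fun _ : Fin n => isoGauss p (v j)),
          ((isoGauss p (v j)) {z : Obs p |
              (∑ k, z.1 k * bhat T k) + L T ≤ z.2
                ∧ z.2 ≤ (∑ k, z.1 k * bhat T k) + U T}).toReal = 1 - α := by
  rintro ⟨bhat, L, U, -, -, -, h⟩
  have key : ∀ i j : Fin 2, v i < v j → False := by
    intro i j hij
    have hac := pi_fin_absolutelyContinuous
      (isoGauss_absolutelyContinuous p (hvpos i).ne' (hvpos j).ne') n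
    obtain ⟨T, hi, hj⟩ := ((h i).and (hac.ae_le (h j))).exists
    have hset : {z : Obs p | (∑ k, z.1 k * bhat T k) + L T ≤ z.2
        ∧ z.2 ≤ (∑ k, z.1 k * bhat T k) + U T}
        = {z | linearResidual (bhat T) z ∈ Set.Icc (L T) (U T)} := by
      ext z
      simp only [linearResidual, Set.mem_ofPred_eq, Set.mem_Icc, le_sub_iff_add_le', sub_le_iff_le_add']
    rw [hset] at hi hj
    have hlt := isoGauss_linearResidual_Icc_lt (bhat T) (hvpos i) hij
      (l := L T) (u := U T) (by rw [Measure.real, hi]; linarith)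
    rw [Measure.real, Measure.real, hi, hj] at hlt
    exact lt_irrefl _ hlt
  rcases hv.lt_or_gt with h01 | h10
  · exact key 0 1 h01
  · exact key 1 0 h10

end
end
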